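/- arXiv:2308.02267 — 2 statements merged into one kernel-verified Lean document; each statement's English description precedes it below -/
import Mathlib

section
/- Let V be a vector space over ℚ and let T : V × V × V → ℚ be a symmetric trilinear form. Let (w_τ)_{τ∈I} be a family of vectors of V indexed by a finite set I of cardinality 16 such that T(w_τ, w_τ, w_τ) = 60 for every τ, T(w_τ, w_τ, w_σ) = 12 for all τ ≠ σ, and T(w_τ, w_σ, w_ρ) = 4 for all pairwise distinct τ, σ, ρ. Then the 16 vectors w_τ are linearly independent. -/
/-- Let `V` be a vector space over `ℚ` and `T : V × V × V → ℚ` a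
symmetric trilinear form.  Let `(w τ)` be a family of vectors indexed by a finite set `I`
of cardinality `16` with `T (w τ) (w τ) (w τ) = 60`, `T (w τ) (w τ) (w σ) = 12` for
`τ ≠ σ`, and `T (w τ) (w σ) (w ρ) = 4` for pairwise distinct `τ, σ, ρ`.  Then the sixteen
vectors `w τ` are linearly independent. -/
theorem stmt_0 {V : Type*} [AddCommGroup V] [Module ℚ V]
    (T : V →ₗ[ℚ] V →ₗ[ℚ] V →ₗ[ℚ] ℚ)
    (hT12 : ∀ a b c : V, T a b c = T b a c)
    (hT23 : ∀ a b c : V, T a b c = T a c b)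
    {I : Type*} [Fintype I] (hI : Fintype.card I = 16)
    (w : I → V)
    (h3 : ∀ τ, T (w τ) (w τ) (w τ) = 60)
    (h2 : ∀ τ σ, τ ≠ σ → T (w τ) (w τ) (w σ) = 12)
    (h1 : ∀ τ σ ρ, τ ≠ σ → σ ≠ ρ → τ ≠ ρ → T (w τ) (w σ) (w ρ) = 4) :
    LinearIndependent ℚ w := by
  classical
  rw [Fintype.linearIndependent_iff]
  intro g hg
  have hval (τ σ : I) : T (w τ) (w τ) (w σ) = 12 + if σ = τ then 48 else 0 := by
    split_ifs with h
    · rw [h, h3]; norm_num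
    · rw [h2 τ σ (Ne.symm h), add_zero]
  have hrel (τ : I) : (∑ σ, g σ) * 12 + g τ * 48 = 0 := by
    have h := congrArg (T (w τ) (w τ)) hg
    simpa [hval, mul_add, Finset.sum_add_distrib, Finset.sum_mul] using h
  have hsum : (∑ σ, g σ) = 0 := by
    have h : ∑ τ, ((∑ σ, g σ) * 12 + g τ * 48) = 0 :=
      Finset.sum_eq_zero fun τ _ => hrel τ
    rw [Finset.sum_add_distrib, Finset.sum_const, ← Finset.sum_mul, Finset.card_univ, hI,
      nsmul_eq_mul] at h
    push_cast at h
    linarith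
  intro τ
  have h := hrel τ
  rw [hsum] at h
  linarith
end

section
/- Let U be a vector space over ℚ with a symmetric bilinear form B, let I and A be finite sets each of cardinality 16, and let (d_{τ,α})_{(τ,α)∈I×A} be 256 vectors of U such that: B(d_{τ,α}, d_{τ,α}) = −52 for all (τ,α); B(d_{τ,α}, d_{τ,α'}) = 12 whenever α ≠ α'; B(d_{τ,α}, d_{τ',α'}) = 8 whenever τ ≠ τ'; and Σ_{α∈A} d_{τ,α} = Σ_{α∈A} d_{τ',α} for all τ, τ' ∈ I. Then the span of the d_{τ,α} has dimension exactly 241, and every linear relation Σ β_{τ,α} d_{τ,α} = 0 with β_{τ,α} ∈ ℚ is a ℚ-linear combination of the 15 relations Σ_{α} d_{τ,α} − Σ_{α} d_{τ₀,α} = 0, τ ∈ I, for a fixed τ₀ ∈ I. -/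
section BlockGram

variable {K U I A : Type*} [Field K] [AddCommGroup U] [Module K U] [Fintype I] [Fintype A]

/-- A linear relation between vectors whose Gram matrix has entries `a` on the diagonal, `b` off
the diagonal in a block and `c` outside the blocks, with `a + (n - 1) b = n c` for blocks of
size `n`, is constant on the blocks, and its values on the blocks add up to zero. -/
lemma relation_of_blockGram (B : U →ₗ[K] U →ₗ[K] K) {a b c : K} {d : I → A → U} [Nonempty A]
    (hab : a ≠ b) (hc : c ≠ 0) (habc : a - b + Fintype.card A * (b - c) = 0)
    (hdiag : ∀ i x, B (d i x) (d i x) = a)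
    (hsame : ∀ i x y, x ≠ y → B (d i x) (d i y) = b)
    (hcross : ∀ i j x y, i ≠ j → B (d i x) (d j y) = c)
    {β : I × A → K} (hβ : ∑ p, β p • d p.1 p.2 = 0) :
    ∃ γ : I → K, β = (fun p => γ p.1) ∧ ∑ i, γ i = 0 := by
  classical
  have key : ∀ i x, (a - b) * β (i, x) + (b - c) * ∑ y, β (i, y) + c * ∑ p, β p = 0 := by
    intro i x
    have hB : ∀ p : I × A, β p * B (d p.1 p.2) (d i x) =
        (if p.1 = i then (if p.2 = x then (a - b) * β p else 0) else 0) +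
          (if p.1 = i then (b - c) * β p else 0) + c * β p := by
      rintro ⟨j, y⟩
      by_cases hj : j = i
      · subst hj
        by_cases hy : y = x
        · subst hy
          simp only [hdiag, if_true]
          ring
        · simp only [hsame j y x hy, if_true, if_neg hy]
          ring
      · simp only [hcross j i y x hj, if_neg hj]
        ring
    have h : ∑ p, β p * B (d p.1 p.2) (d i x) = 0 := by
      simpa using congrArg (fun u => B u (d i x)) hβ
    simp_rw [hB, Finset.sum_add_distrib, ← Finset.mul_sum] at h
    rw [Fintype.sum_prod_type, Fintype.sum_prod_type_right
      (f := fun p : I × A => if p.1 = i then (b - c) * β p else 0)] at h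
    simpa [Finset.mul_sum] using h
  have hab' : a - b ≠ 0 := sub_ne_zero.mpr hab
  have hn : (Fintype.card A : K) ≠ 0 := by
    intro h
    rw [h, zero_mul, add_zero] at habc
    exact hab' habc
  obtain ⟨x₀⟩ := ‹Nonempty A›
  have hconst : ∀ i x, β (i, x) = β (i, x₀) := fun i x =>
    mul_left_cancel₀ hab' (by linear_combination key i x - key i x₀)
  refine ⟨fun i => β (i, x₀), funext fun p => hconst p.1 p.2, ?_⟩
  have htotal : ∑ p, β p = Fintype.card A * ∑ i, β (i, x₀) := by
    simp [Fintype.sum_prod_type, hconst, Finset.mul_sum]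
  rcases isEmpty_or_nonempty I with hI | ⟨⟨i⟩⟩
  · simp
  · have h := key i x₀
    simp only [hconst i, Finset.sum_const, Finset.card_univ, nsmul_eq_mul, htotal] at h
    refine (mul_eq_zero.mp (?_ : c * Fintype.card A * ∑ i, β (i, x₀) = 0)).resolve_left
      (mul_ne_zero hc hn)
    linear_combination h - β (i, x₀) * habc

/-- If the linear relations between the vectors `d i x` are exactly those that are constant on the
blocks with block values adding up to zero, then the vectors span a space of dimension
`card I * card A - (card I - 1)`. -/
lemma finrank_span_add_card_of_relations [Nonempty I] [Nonempty A] {d : I → A → U}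
    (hsum : ∀ i j, ∑ x, d i x = ∑ x, d j x)
    (hrel : ∀ β : I × A → K, ∑ p, β p • d p.1 p.2 = 0 →
      ∃ γ : I → K, β = (fun p => γ p.1) ∧ ∑ i, γ i = 0) :
    Module.finrank K (Submodule.span K (Set.range fun p : I × A => d p.1 p.2)) + Fintype.card I =
      Fintype.card I * Fintype.card A + 1 := by
  classical
  let L := Fintype.linearCombination K (fun p : I × A => d p.1 p.2)
  let σ : Module.Dual K (I → K) := Fintype.linearCombination K (fun _ : I => (1 : K))
  let e : (I → K) →ₗ[K] (I × A → K) := LinearMap.funLeft K K Prod.fst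
  have he : Function.Injective e :=
    LinearMap.funLeft_injective_of_surjective K K _ Prod.fst_surjective
  have hσ : ∀ γ, σ γ = ∑ i, γ i := fun γ => by
    simp [σ, Fintype.linearCombination_apply]
  have hker : LinearMap.ker L = (LinearMap.ker σ).map e := by
    ext β
    simp only [LinearMap.mem_ker, Submodule.mem_map, hσ]
    constructor
    · intro h
      obtain ⟨γ, rfl, hγ⟩ := hrel β (by simpa [L, Fintype.linearCombination_apply] using h)
      exact ⟨γ, hγ, rfl⟩
    · rintro ⟨γ, hγ, rfl⟩
      obtain ⟨j⟩ := ‹Nonempty I›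
      simp [L, e, Fintype.linearCombination_apply, Fintype.sum_prod_type, LinearMap.funLeft_apply,
        ← Finset.smul_sum, hsum _ j, ← Finset.sum_smul, hγ]
  have hσ0 : σ ≠ 0 := by
    intro h
    obtain ⟨j⟩ := ‹Nonempty I›
    simpa [hσ] using LinearMap.congr_fun h (Pi.single j 1)
  have h₁ := Module.Dual.finrank_ker_add_one_of_ne_zero hσ0
  have h₂ := L.finrank_range_add_finrank_ker
  rw [hker, (Submodule.equivMapOfInjective e he _).finrank_eq.symm,
    Fintype.range_linearCombination] at h₂
  simp only [Module.finrank_fintype_fun_eq_card, Fintype.card_prod] at h₁ h₂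
  omega

end BlockGram

/-- **the core linear algebra of Proposition 6.5 of the paper.** Let `U`
be a vector space over `ℚ` with a symmetric bilinear form `B`, let `I` and `A` be finite
sets each of cardinality 16, and let `(d τ α)` be 256 vectors of `U` such that
`B (d τ α) (d τ α) = -52`, `B (d τ α) (d τ α') = 12` for `α ≠ α'`,
`B (d τ α) (d τ' α') = 8` for `τ ≠ τ'`, and `∑ α, d τ α = ∑ α, d τ' α` for all `τ, τ'`.
Then the span of the `d τ α` has dimension exactly `241`, and every linear relation
`∑ β (τ,α) • d τ α = 0` is a `ℚ`-linear combination of the 15 relations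
`∑ α, d τ α − ∑ α, d τ₀ α = 0` (`τ ∈ I`), for a fixed `τ₀ ∈ I`  (the relation indexed by
`τ` has coefficient vector `(τ',α) ↦ (if τ' = τ then 1 else 0) − (if τ' = τ₀ then 1
else 0)`; including `τ = τ₀` only adds the zero relation). -/
theorem stmt_10 {U : Type*} [AddCommGroup U] [Module ℚ U]
    (B : U →ₗ[ℚ] U →ₗ[ℚ] ℚ) (hBsym : ∀ x y, B x y = B y x)
    {I A : Type*} [Fintype I] [Fintype A] [DecidableEq I]
    (hI : Fintype.card I = 16) (hA : Fintype.card A = 16)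
    (d : I → A → U)
    (hdiag : ∀ τ α, B (d τ α) (d τ α) = -52)
    (hsame : ∀ τ α α', α ≠ α' → B (d τ α) (d τ α') = 12)
    (hcross : ∀ τ τ' α α', τ ≠ τ' → B (d τ α) (d τ' α') = 8)
    (hsum : ∀ τ τ', ∑ α, d τ α = ∑ α, d τ' α) :
    Module.finrank ℚ
      (Submodule.span ℚ (Set.range fun p : I × A => d p.1 p.2)) = 241 ∧
    ∀ (τ₀ : I) (β : I × A → ℚ), (∑ p : I × A, β p • d p.1 p.2) = 0 →
      ∃ γ : I → ℚ, β = ∑ τ, γ τ • (fun p : I × A =>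
        (if p.1 = τ then (1 : ℚ) else 0) - (if p.1 = τ₀ then (1 : ℚ) else 0)) := by
  have : Nonempty I := Fintype.card_pos_iff.mp (by omega)
  have : Nonempty A := Fintype.card_pos_iff.mp (by omega)
  have hrel : ∀ β : I × A → ℚ, ∑ p, β p • d p.1 p.2 = 0 →
      ∃ γ : I → ℚ, β = (fun p => γ p.1) ∧ ∑ τ, γ τ = 0 := fun β hβ =>
    relation_of_blockGram B (by norm_num) (by norm_num) (by rw [hA]; norm_num)
      hdiag hsame hcross hβ
  refine ⟨?_, fun τ₀ β hβ => ?_⟩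
  · have h := finrank_span_add_card_of_relations hsum hrel
    rw [hI, hA] at h
    omega
  · obtain ⟨γ, rfl, hγ⟩ := hrel β hβ
    refine ⟨γ, funext fun p => ?_⟩
    simp [mul_sub, Finset.sum_sub_distrib, hγ]
end
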